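/- arXiv:2109.11111 — 3 statements merged into one kernel-verified Lean document; each statement's English description precedes it below -/
import Mathlib

section
/- Let 𝔽 be a number field and θ_1, θ_2, w ∈ ℂ with Re(w) > max(1, 1 + Re(θ_1), 1 + Re(θ_2), 1 + Re(θ_1 + θ_2)). Then Σ_{nonzero ideals n} σ_{θ_1}(n)·σ_{θ_2}(n)/N(n)^w = ζ_𝔽(w)·ζ_𝔽(w − θ_1)·ζ_𝔽(w − θ_2)·ζ_𝔽(w − θ_1 − θ_2)/ζ_𝔽(2w − θ_1 − θ_2) (the Ramanujan identity over 𝔽). -/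
open NumberField

/-- The Dedekind zeta function of `F` as a Dirichlet series over nonzero integral ideals,
valid for `Re s > 1`. -/
noncomputable def dzeta (F : Type) [Field F] [NumberField F] (s : ℂ) : ℂ :=
  ∑' I : {I : Ideal (𝓞 F) // I ≠ 0}, (Ideal.absNorm I.1 : ℂ) ^ (-s)

/-- The weighted divisor function `σ_θ(n) = Σ_{d ∣ n} N(d)^θ` on integral ideals. -/
noncomputable def sigmaIdeal {F : Type} [Field F] [NumberField F]
    (θ : ℂ) (n : Ideal (𝓞 F)) : ℂ :=
  ∑ᶠ d ∈ {d : Ideal (𝓞 F) | d ∣ n}, (Ideal.absNorm d : ℂ) ^ θ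

namespace RamId
open Filter Ideal Topology nonZeroDivisors

theorem summable_nat (F : Type) [Field F] [NumberField F] {s : ℂ} (hs : 1 < s.re) :
    LSeriesSummable (fun n ↦ ((Nat.card {I : Ideal (𝓞 F) // absNorm I = n} : ℝ) : ℂ)) s := by
  refine LSeriesSummable_of_sum_norm_bigO_and_nonneg
    (f := fun n ↦ (Nat.card {I : Ideal (𝓞 F) // absNorm I = n} : ℝ)) (r := 1) ?_
    (fun _ ↦ Nat.cast_nonneg _) zero_le_one hs
  have key : Tendsto (fun n : ℕ ↦ (∑ k ∈ Finset.Icc 1 n, (Nat.card {I : Ideal (𝓞 F) // absNorm I = k} : ℝ)) / (n : ℝ)) atTop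
      (𝓝 (NumberField.dedekindZeta_residue F)) := by
    refine ((Ideal.tendsto_norm_le_div_atTop₀ F).comp tendsto_natCast_atTop_atTop).congr fun n ↦ ?_
    simp only [Function.comp_apply, Nat.cast_le, ← Nat.cast_sum]
    congr
    rw [← add_left_inj 1, ← card_norm_le_eq_card_norm_le_add_one,
      show Finset.Icc 1 n = Finset.Ioc 0 n from Finset.Icc_succ_left_eq_Ioc _ _,
      show 1 = Nat.card {I : Ideal (𝓞 F) // absNorm I = 0} by simp [Ideal.absNorm_eq_zero_iff],
      Finset.sum_Ioc_add_eq_sum_Icc (n.zero_le),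
      ← Finset.card_preimage_eq_sum_card_image_eq (fun k _ ↦ finite_setOfPred_absNorm_eq k)]
    simp [Set.coe_eq_subtype]
  have := Asymptotics.isBigO_of_div_tendsto_nhds (l := atTop) (g := fun n : ℕ ↦ (n : ℝ)) ?_ _ key
  · simpa using this
  · filter_upwards [eventually_ne_atTop 0] with n hn h
    simp [hn] at h

theorem summable_f (F : Type) [Field F] [NumberField F] {s : ℂ} (hs : 1 < s.re) :
    Summable fun I : {I : Ideal (𝓞 F) // I ≠ 0} ↦ ‖(absNorm I.1 : ℂ) ^ (-s)‖ := by
  have h0 : (-s) ≠ 0 := by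
    intro h; rw [neg_eq_zero] at h; subst h; simp at hs; linarith
  suffices h : Summable fun I : Ideal (𝓞 F) ↦ ‖(absNorm I : ℂ) ^ (-s)‖ from
    h.comp_injective Subtype.val_injective
  rw [← (Equiv.sigmaFiberEquiv (fun I : Ideal (𝓞 F) ↦ absNorm I)).summable_iff]
  have hfin (n : ℕ) : Finite {I : Ideal (𝓞 F) // absNorm I = n} := finite_setOfPred_absNorm_eq n
  refine (summable_sigma_of_nonneg (fun _ ↦ norm_nonneg _)).2 ⟨fun n ↦ Summable.of_finite, ?_⟩
  refine (summable_nat F hs).norm.congr fun n ↦ ?_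
  have : ∀ y : {I : Ideal (𝓞 F) // absNorm I = n}, ((fun I : Ideal (𝓞 F) ↦ ‖(absNorm I : ℂ) ^ (-s)‖) ∘
     (Equiv.sigmaFiberEquiv (fun I : Ideal (𝓞 F) ↦ absNorm I))) ⟨n, y⟩ = ‖(n : ℂ) ^ (-s)‖ := by
    rintro ⟨y, rfl⟩; rfl
  refine Eq.trans ?_ (tsum_congr this).symm
  rw [tsum_const, LSeries.norm_term_eq]
  split_ifs with hn
  · subst hn; simp [h0]
  · rw [Complex.norm_natCast_cpow_of_pos (Nat.pos_of_ne_zero hn), Complex.neg_re, Real.rpow_neg (by positivity)]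
    simp [div_eq_mul_inv]

theorem f_mul {F : Type} [Field F] [NumberField F] (s : ℂ) (I J : Ideal (𝓞 F)) :
    (absNorm (I * J) : ℂ) ^ s = (absNorm I : ℂ) ^ s * (absNorm J : ℂ) ^ s := by
  rw [map_mul, Nat.cast_mul, Complex.natCast_mul_natCast_cpow]

theorem step {F : Type} [Field F] [NumberField F] {s : ℂ} (hs : 1 < s.re)
    (h0 : dzeta F s = 0) (S : Finset (Ideal (𝓞 F))) (hS : ∀ p ∈ S, Prime p) :
    ∑' I : {I : Ideal (𝓞 F) // I ≠ 0 ∧ ∀ p ∈ S, ¬ p ∣ I}, (absNorm I.1 : ℂ) ^ (-s) = 0 := by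
  classical
  have hsum : Summable fun I : {I : Ideal (𝓞 F) // I ≠ 0} ↦ (absNorm I.1 : ℂ) ^ (-s) :=
    (summable_f F hs).of_norm
  induction S using Finset.induction with
  | empty =>
    rw [← h0, dzeta]
    exact (Equiv.subtypeEquivRight (by simp)).tsum_eq
      (fun I : {I : Ideal (𝓞 F) // I ≠ 0} ↦ (absNorm I.1 : ℂ) ^ (-s))
  | insert p S hp ih =>
    have ih := ih (fun q hq ↦ hS q (Finset.mem_insert_of_mem hq))
    have hpp : Prime p := hS p (Finset.mem_insert_self _ _)
    set A := {I : Ideal (𝓞 F) // I ≠ 0 ∧ ∀ p ∈ S, ¬ p ∣ I}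
    have hsA : Summable fun I : A ↦ (absNorm I.1 : ℂ) ^ (-s) :=
      hsum.comp_injective (i := fun I : A ↦ (⟨I.1, I.2.1⟩ : {I : Ideal (𝓞 F) // I ≠ 0}))
        (fun a b h ↦ Subtype.ext (by simpa using h))
    have h1 := hsA.tsum_subtype_add_tsum_subtype_compl {I : A | p ∣ I.1}
    let e : A ≃ {I : A | p ∣ I.1} := Equiv.ofBijective
      (fun J ↦ ⟨⟨p * J.1, mul_ne_zero hpp.ne_zero J.2.1, fun q hq hd ↦ by
        have hqp : Prime q := hS q (Finset.mem_insert_of_mem hq)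
        rcases hqp.dvd_or_dvd hd with h | h
        · exact hp ((associated_iff_eq.1 (hqp.associated_of_dvd hpp h)) ▸ hq)
        · exact J.2.2 q hq h⟩, dvd_mul_right _ _⟩) (by
        constructor
        · intro J K h
          have h' : p * J.1 = p * K.1 := congrArg (fun x ↦ x.1.1) h
          exact Subtype.ext (mul_left_cancel₀ hpp.ne_zero h')
        · rintro ⟨⟨I, hI, hI'⟩, J, hJ⟩
          simp only at hJ
          subst hJ
          exact ⟨⟨J, right_ne_zero_of_mul hI, fun q hq hd ↦ hI' q hq (hd.mul_left _)⟩, rfl⟩)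
    have h2 : ∑' I : {I : A | p ∣ I.1}, (absNorm I.1.1 : ℂ) ^ (-s) = 0 := by
      rw [← e.tsum_eq]
      have : ∀ J : A, (absNorm (e J).1.1 : ℂ) ^ (-s) = (absNorm p : ℂ) ^ (-s) * (absNorm J.1 : ℂ) ^ (-s) :=
        fun J ↦ f_mul _ _ _
      rw [tsum_congr this, tsum_mul_left, ih, mul_zero]
    rw [h2, ih, zero_add] at h1
    rw [← h1]
    let e' : {I : Ideal (𝓞 F) // I ≠ 0 ∧ ∀ q ∈ insert p S, ¬ q ∣ I} ≃ ({I : A | p ∣ I.1}ᶜ : Set A) :=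
      { toFun := fun I ↦ ⟨⟨I.1, I.2.1, fun q hq ↦ I.2.2 q (Finset.mem_insert_of_mem hq)⟩,
          I.2.2 p (Finset.mem_insert_self _ _)⟩
        invFun := fun I ↦ ⟨I.1.1, I.1.2.1, fun q hq ↦ by
          rcases Finset.mem_insert.1 hq with rfl | hq
          · exact I.2
          · exact I.1.2.2 q hq⟩
        left_inv := fun _ ↦ rfl
        right_inv := fun _ ↦ rfl }
    exact e'.tsum_eq (fun I : ({I : A | p ∣ I.1}ᶜ : Set A) ↦ (absNorm I.1.1 : ℂ) ^ (-s))

theorem small_contra {B : Type} [DecidableEq B] {g : B → ℂ} (hB : HasSum g 0) (o : B)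
    (ho : g o = 1) (hb : ∀ V : Finset B, o ∉ V → ‖∑ I ∈ V, g I‖ < 1/2) : False := by
  have hev : ∀ᶠ W : Finset B in atTop, ‖∑ I ∈ W, g I‖ < 1/2 := by
    have h1 : Tendsto (fun W : Finset B ↦ ‖∑ I ∈ W, g I‖) atTop (𝓝 0) := by
      have h2 : Tendsto (fun W : Finset B ↦ ∑ I ∈ W, g I) atTop (𝓝 0) := hB
      simpa using h2.norm
    exact h1.eventually_lt_const (by norm_num)
  obtain ⟨W, hW, hoW⟩ := (hev.and (eventually_ge_atTop {o})).exists
  have hoW : o ∈ W := Finset.singleton_subset_iff.1 hoW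
  rw [← Finset.add_sum_erase W _ hoW, ho] at hW
  have h3 := hb (W.erase o) (Finset.notMem_erase _ _)
  have h4 := norm_sub_le (1 + ∑ I ∈ W.erase o, g I)
    (∑ I ∈ W.erase o, g I)
  rw [add_sub_cancel_right, norm_one] at h4
  linarith

theorem exists_S {F : Type} [Field F] [NumberField F] (T : Finset {I : Ideal (𝓞 F) // I ≠ 0}) :
    ∃ S : Finset (Ideal (𝓞 F)), (∀ p ∈ S, Prime p) ∧
      ∀ I ∈ T, ∀ p, Prime p → p ∣ I.1 → p ∈ S := by
  have hfin : (⋃ I ∈ T, {p : Ideal (𝓞 F) | Prime p ∧ p ∣ I.1}).Finite := by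
    refine T.finite_toSet.biUnion fun I _ ↦ ?_
    have : Finite {d : Ideal (𝓞 F) // d ∣ I.1} :=
      (UniqueFactorizationMonoid.fintypeSubtypeDvd I.1 I.2).finite
    have h2 : {d : Ideal (𝓞 F) | d ∣ I.1}.Finite := this
    exact h2.subset fun p hp ↦ hp.2
  refine ⟨hfin.toFinset, fun p hp ↦ ?_, fun I hI p hp hd ↦ ?_⟩
  · simp only [Set.Finite.mem_toFinset, Set.mem_iUnion] at hp
    obtain ⟨I, -, hI⟩ := hp
    exact hI.1
  · simp only [Set.Finite.mem_toFinset, Set.mem_iUnion]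
    exact ⟨I, hI, hp, hd⟩

theorem small_contra' {X B : Type} [DecidableEq B] {f : X → ℂ} (hf : Summable fun x ↦ ‖f x‖)
    (T : Finset X) (hT : ∀ t : Finset X, Disjoint t T → ‖∑ x ∈ t, ‖f x‖‖ < 1/2)
    (i : B → X) (hi : Function.Injective i) (o : B) (ho : f (i o) = 1)
    (hdisj : ∀ I : B, I ≠ o → i I ∉ T) (h : ∑' I : B, f (i I) = 0) : False := by
  have hB1 : Summable fun I : B ↦ ‖f (i I)‖ := hf.comp_injective hi
  have hB : HasSum (fun I : B ↦ f (i I)) 0 := by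
    rw [← h]; exact hB1.of_norm.hasSum
  refine small_contra hB o ho fun V hV ↦ ?_
  have := hT (V.map ⟨i, hi⟩) (by
    rw [Finset.disjoint_left]
    intro x hx
    obtain ⟨I, hI, rfl⟩ := Finset.mem_map.1 hx
    exact hdisj I (fun h ↦ hV (h ▸ hI)))
  rw [Finset.sum_map, Real.norm_of_nonneg (Finset.sum_nonneg fun _ _ ↦ norm_nonneg _)] at this
  exact (norm_sum_le _ _).trans_lt this

theorem eq_one_of {F : Type} [Field F] [NumberField F] (I : Ideal (𝓞 F)) (h0 : I ≠ 0)
    (h : ∀ p, Prime p → ¬ p ∣ I) : I = 1 := by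
  by_contra hne
  obtain ⟨p, hp, hpd⟩ := WfDvdMonoid.exists_irreducible_factor
    (fun hu : IsUnit I ↦ hne (by simpa using hu)) h0
  exact h p hp.prime hpd

theorem dzeta_ne_zero {F : Type} [Field F] [NumberField F] {s : ℂ} (hs : 1 < s.re) :
    dzeta F s ≠ 0 := by
  classical
  intro h0
  have hsn := summable_f F hs
  obtain ⟨T, hT⟩ := summable_iff_vanishing_norm.1 hsn (1/2) (by norm_num)
  obtain ⟨S, hSp, hSc⟩ := exists_S T
  have h := step hs h0 S hSp
  refine small_contra' hsn T hT
    (fun I : {I : Ideal (𝓞 F) // I ≠ 0 ∧ ∀ p ∈ S, ¬ p ∣ I} ↦ ⟨I.1, I.2.1⟩) ?_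
    ⟨1, one_ne_zero, fun p hp hd ↦ (hSp p hp).not_isUnit (isUnit_of_dvd_one hd)⟩ ?_ ?_ h
  · intro a b hab
    exact Subtype.ext (Subtype.mk.inj hab)
  · simp only [map_one, Nat.cast_one, Complex.one_cpow]
  · intro I hI hIT
    exact hI (Subtype.ext (eq_one_of I.1 I.2.1 fun p hp hd ↦ I.2.2 p (hSc _ hIT p hp hd) hd))

/-- Coprime pairs of nonzero ideals. -/
abbrev Cop (F : Type) [Field F] [NumberField F] : Type :=
  {x : {I : Ideal (𝓞 F) // I ≠ 0} × {I : Ideal (𝓞 F) // I ≠ 0} // x.1.1 ⊔ x.2.1 = 1}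

/-- Product of nonzero ideals. -/
def nzmul {F : Type} [Field F] [NumberField F] (x y : {I : Ideal (𝓞 F) // I ≠ 0}) :
    {I : Ideal (𝓞 F) // I ≠ 0} := ⟨x.1 * y.1, mul_ne_zero x.2 y.2⟩

theorem bij1 (F : Type) [Field F] [NumberField F] :
    Function.Bijective (fun x : {I : Ideal (𝓞 F) // I ≠ 0} × Cop F ↦
      (nzmul x.1 x.2.1.1, nzmul x.1 x.2.1.2)) := by
  constructor
  · rintro ⟨⟨g, hg⟩, ⟨⟨⟨b, hb⟩, ⟨c, hc⟩⟩, h⟩⟩ ⟨⟨g', hg'⟩, ⟨⟨⟨b', hb'⟩, ⟨c', hc'⟩⟩, h'⟩⟩ he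
    simp only [nzmul, Prod.mk.injEq, Subtype.mk.injEq] at he h h' ⊢
    obtain ⟨h1, h2⟩ := he
    have : g = g' := by
      calc g = g * (b ⊔ c) := by rw [h, mul_one]
        _ = g' * (b' ⊔ c') := by rw [Ideal.mul_sup, Ideal.mul_sup, h1, h2]
        _ = g' := by rw [h', mul_one]
    subst this
    exact ⟨rfl, mul_left_cancel₀ hg h1, mul_left_cancel₀ hg h2⟩
  · rintro ⟨⟨b, hb⟩, ⟨c, hc⟩⟩
    obtain ⟨b', h1⟩ := Ideal.dvd_iff_le.2 (le_sup_left : b ≤ b ⊔ c)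
    obtain ⟨c', h2⟩ := Ideal.dvd_iff_le.2 (le_sup_right : c ≤ b ⊔ c)
    have hg : b ⊔ c ≠ 0 := fun h ↦ hb (by rw [h1, h, zero_mul])
    have hcop : b' ⊔ c' = 1 := by
      apply mul_left_cancel₀ hg
      rw [Ideal.mul_sup, ← h1, ← h2, mul_one]
    have hb' : b' ≠ 0 := fun h ↦ hb (by rw [h1, h, mul_zero])
    have hc' : c' ≠ 0 := fun h ↦ hc (by rw [h2, h, mul_zero])
    refine ⟨⟨⟨b ⊔ c, hg⟩, ⟨⟨⟨b', hb'⟩, ⟨c', hc'⟩⟩, hcop⟩⟩, ?_⟩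
    exact Prod.ext (Subtype.ext h1.symm) (Subtype.ext h2.symm)

/-- The parametrization of pairs of divisors. -/
def par (F : Type) [Field F] [NumberField F]
    (x : {I : Ideal (𝓞 F) // I ≠ 0} × ({I : Ideal (𝓞 F) // I ≠ 0} × Cop F)) :
    (Σ n : {I : Ideal (𝓞 F) // I ≠ 0}, {d : Ideal (𝓞 F) // d ∣ n.1} × {d : Ideal (𝓞 F) // d ∣ n.1}) :=
  ⟨nzmul (nzmul x.1 x.2.1) (nzmul x.2.2.1.1 x.2.2.1.2),
    ⟨x.2.1.1 * x.2.2.1.1.1, x.1.1 * x.2.2.1.2.1, by simp only [nzmul]; ring⟩,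
    ⟨x.2.1.1 * x.2.2.1.2.1, x.1.1 * x.2.2.1.1.1, by simp only [nzmul]; ring⟩⟩

theorem sig_ext {F : Type} [Field F] [NumberField F]
    (x y : (Σ n : {I : Ideal (𝓞 F) // I ≠ 0},
      {d : Ideal (𝓞 F) // d ∣ n.1} × {d : Ideal (𝓞 F) // d ∣ n.1})) (h1 : x.1.1 = y.1.1)
    (h2 : x.2.1.1 = y.2.1.1) (h3 : x.2.2.1 = y.2.2.1) : x = y := by
  obtain ⟨⟨n, hn⟩, ⟨d, hd⟩, ⟨e, he⟩⟩ := x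
  obtain ⟨⟨n', hn'⟩, ⟨d', hd'⟩, ⟨e', he'⟩⟩ := y
  simp only at h1 h2 h3
  subst h1 h2 h3
  rfl

theorem bij2 (F : Type) [Field F] [NumberField F] : Function.Bijective (par F) := by
  constructor
  · rintro ⟨a, x⟩ ⟨a', x'⟩ he
    have h1 : (par F (a, x)).1.1 = (par F (a', x')).1.1 := by rw [he]
    have h2 : (par F (a, x)).2.1.1 = (par F (a', x')).2.1.1 := by rw [he]
    have h3 : (par F (a, x)).2.2.1 = (par F (a', x')).2.2.1 := by rw [he]
    have hx : x = x' := (bij1 F).1 (Prod.ext (Subtype.ext h2) (Subtype.ext h3))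
    subst hx
    have ha : a.1 = a'.1 := by
      simp only [par, nzmul, mul_assoc] at h1
      exact mul_right_cancel₀ (mul_ne_zero x.1.2 (mul_ne_zero x.2.1.1.2 x.2.1.2.2)) h1
    rw [Subtype.ext ha]
  · rintro ⟨⟨n, hn⟩, ⟨d₁, h₁⟩, ⟨d₂, h₂⟩⟩
    simp only at h₁ h₂
    obtain ⟨⟨d, ⟨⟨b, c⟩, hbc⟩⟩, hx⟩ := (bij1 F).2
      (⟨d₁, ne_zero_of_dvd_ne_zero hn h₁⟩, ⟨d₂, ne_zero_of_dvd_ne_zero hn h₂⟩)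
    simp only [nzmul, Prod.mk.injEq, Subtype.mk.injEq] at hx
    obtain ⟨rfl, rfl⟩ := hx
    obtain ⟨m, rfl⟩ := (dvd_mul_right _ _).trans h₁
    have hb : b.1 ∣ m := (mul_dvd_mul_iff_left d.2).1 h₁
    have hc : c.1 ∣ m := (mul_dvd_mul_iff_left d.2).1 h₂
    obtain ⟨a, rfl⟩ := (Ideal.isCoprime_iff_add.2 hbc).mul_dvd hb hc
    refine ⟨⟨⟨a, right_ne_zero_of_mul (right_ne_zero_of_mul hn)⟩, d, ⟨⟨b, c⟩, hbc⟩⟩, ?_⟩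
    refine sig_ext _ _ ?_ rfl rfl
    simp only [par, nzmul]
    ring

theorem sigma_eq {F : Type} [Field F] [NumberField F] (θ : ℂ) (n : Ideal (𝓞 F)) (hn : n ≠ 0) :
    sigmaIdeal θ n = ∑' d : {d : Ideal (𝓞 F) // d ∣ n}, (absNorm d.1 : ℂ) ^ θ := by
  have : Finite {d : Ideal (𝓞 F) // d ∣ n} :=
    (UniqueFactorizationMonoid.fintypeSubtypeDvd n hn).finite
  rw [sigmaIdeal, ← finsum_set_coe_eq_finsum_mem {d : Ideal (𝓞 F) | d ∣ n}]
  have : Finite {d : Ideal (𝓞 F) | d ∣ n} := this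
  exact (tsum_eq_finsum (L := .unconditional _) (Set.toFinite _)).symm

end RamId

open RamId in
theorem ramanujan_identity (F : Type) [Field F] [NumberField F] (θ₁ θ₂ w : ℂ)
    (hw : max (max 1 (1 + θ₁.re)) (max (1 + θ₂.re) (1 + (θ₁ + θ₂).re)) < w.re) :
    ∑' n : {I : Ideal (𝓞 F) // I ≠ 0},
        sigmaIdeal θ₁ n.1 * sigmaIdeal θ₂ n.1 / (Ideal.absNorm n.1 : ℂ) ^ w
      = dzeta F w * dzeta F (w - θ₁) * dzeta F (w - θ₂) * dzeta F (w - θ₁ - θ₂) /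
          dzeta F (2 * w - θ₁ - θ₂) := by
  simp only [max_lt_iff, Complex.add_re] at hw
  obtain ⟨⟨hw0, hw1⟩, hw2, hw3⟩ := hw
  have s0 := summable_f F hw0
  have s1 := summable_f F (s := w - θ₁) (by simp; linarith)
  have s2 := summable_f F (s := w - θ₂) (by simp; linarith)
  have s3 := summable_f F (s := w - θ₁ - θ₂) (by simp; linarith)
  have hs4 : 1 < (2 * w - θ₁ - θ₂).re := by simp; linarith
  have s4 := summable_f F hs4
  have hN : ∀ I : {I : Ideal (𝓞 F) // I ≠ 0}, (Ideal.absNorm I.1 : ℂ) ≠ 0 := fun I ↦ by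
    simpa [Ideal.absNorm_eq_zero_iff] using I.2
  let P : Cop F → ℂ := fun x ↦
    (Ideal.absNorm x.1.1.1 : ℂ) ^ (-(w - θ₁)) * (Ideal.absNorm x.1.2.1 : ℂ) ^ (-(w - θ₂))
  have sP : Summable fun x ↦ ‖P x‖ := (s1.mul_norm s2).comp_injective Subtype.val_injective
  have e1 : dzeta F (w - θ₁) * dzeta F (w - θ₂) = dzeta F (2 * w - θ₁ - θ₂) * ∑' x, P x := by
    rw [dzeta, dzeta, dzeta, tsum_mul_tsum_of_summable_norm s1 s2,
      tsum_mul_tsum_of_summable_norm s4 sP, ← (Equiv.ofBijective _ (bij1 F)).tsum_eq]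
    refine tsum_congr fun x ↦ ?_
    simp only [Equiv.ofBijective_apply, nzmul, f_mul, P]
    rw [show -(2 * w - θ₁ - θ₂) = -(w - θ₁) + -(w - θ₂) by ring, Complex.cpow_add _ _ (hN _)]
    ring
  let Q : (Σ n : {I : Ideal (𝓞 F) // I ≠ 0},
      {d : Ideal (𝓞 F) // d ∣ n.1} × {d : Ideal (𝓞 F) // d ∣ n.1}) → ℂ := fun x ↦
    (Ideal.absNorm x.2.1.1 : ℂ) ^ θ₁ * (Ideal.absNorm x.2.2.1 : ℂ) ^ θ₂ *
      (Ideal.absNorm x.1.1 : ℂ) ^ (-w)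
  have hQ : ∀ x, Q (Equiv.ofBijective _ (bij2 F) x) = (Ideal.absNorm x.1.1 : ℂ) ^ (-w) *
      ((Ideal.absNorm x.2.1.1 : ℂ) ^ (-(w - θ₁ - θ₂)) * P x.2.2) := by
    rintro ⟨a, d, ⟨⟨b, c⟩, h⟩⟩
    simp only [Equiv.ofBijective_apply, par, nzmul, f_mul, P, Q]
    rw [show -(w - θ₁ - θ₂) = -w + θ₁ + θ₂ by ring, show -(w - θ₁) = -w + θ₁ by ring,
      show -(w - θ₂) = -w + θ₂ by ring]
    simp only [Complex.cpow_add _ _ (hN _)]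
    ring
  have sQ : Summable Q := by
    rw [← (Equiv.ofBijective _ (bij2 F)).summable_iff]
    exact (s0.mul_norm (s3.mul_norm sP)).of_norm.congr fun x ↦ (hQ x).symm
  have e2 : ∑' x, Q x = dzeta F w * (dzeta F (w - θ₁ - θ₂) * ∑' x, P x) := by
    rw [dzeta, dzeta, tsum_mul_tsum_of_summable_norm s3 sP,
      tsum_mul_tsum_of_summable_norm s0 (s3.mul_norm sP),
      ← (Equiv.ofBijective _ (bij2 F)).tsum_eq]
    exact tsum_congr hQ
  have hfin : ∀ n : {I : Ideal (𝓞 F) // I ≠ 0}, Finite {d : Ideal (𝓞 F) // d ∣ n.1} := fun n ↦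
    (UniqueFactorizationMonoid.fintypeSubtypeDvd n.1 n.2).finite
  have e3 : ∑' n : {I : Ideal (𝓞 F) // I ≠ 0},
        sigmaIdeal θ₁ n.1 * sigmaIdeal θ₂ n.1 / (Ideal.absNorm n.1 : ℂ) ^ w = ∑' x, Q x := by
    rw [Summable.tsum_sigma' (fun n ↦ Summable.of_finite) sQ]
    refine tsum_congr fun n ↦ ?_
    rw [sigma_eq _ _ n.2, sigma_eq _ _ n.2, tsum_mul_tsum_of_summable_norm Summable.of_finite
      Summable.of_finite, div_eq_mul_inv, ← Complex.cpow_neg, ← tsum_mul_right]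
  rw [e3, e2, eq_div_iff (dzeta_ne_zero hs4)]
  linear_combination (-dzeta F w * dzeta F (w - θ₁ - θ₂)) * e1
end

section
/- Let 𝔽 be a number field, let n be a nonzero integral ideal of O_𝔽, and let s ∈ ℂ with Re(s) > 1. Then Σ_{nonzero ideals m} c_m(n)/N(m)^s = σ_{1−s}(n)/ζ_𝔽(s). -/
open NumberField Classical

/-- The Möbius function of a nonzero integral ideal: `0` if the ideal is not squarefree,
and `(-1)^r` if it is a product of `r` distinct prime ideals. -/
noncomputable def idealMu {F : Type} [Field F] [NumberField F] (I : Ideal (𝓞 F)) : ℤ :=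
  if Squarefree I then (-1) ^ Multiset.card (UniqueFactorizationMonoid.factors I) else 0

/-- The Ramanujan sum `c_m(n) = Σ_{d ∣ m, d ∣ n} N(d)·μ(m/d)`, written as a sum over
factorizations `m = d·e` with `d ∣ n` of `N(d)·μ(e)`. -/
noncomputable def ramanujanSum {F : Type} [Field F] [NumberField F]
    (m n : Ideal (𝓞 F)) : ℤ :=
  ∑ᶠ p ∈ {p : Ideal (𝓞 F) × Ideal (𝓞 F) | p.1 * p.2 = m ∧ p.1 ∣ n},
    (Ideal.absNorm p.1 : ℤ) * idealMu p.2

section helpers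

open UniqueFactorizationMonoid Filter Topology

variable {F : Type} [Field F] [NumberField F]

lemma idealMu_eq (I : Ideal (𝓞 F)) : idealMu I = moebius I := by
  unfold idealMu moebius
  congr

lemma finite_dvd (m : Ideal (𝓞 F)) (hm : m ≠ 0) : {d : Ideal (𝓞 F) | d ∣ m}.Finite := by
  have := fintypeSubtypeDvd m hm
  exact Set.finite_coe_iff.mp (inferInstanceAs (Finite {d : Ideal (𝓞 F) // d ∣ m}))

lemma finite_anti (m : Ideal (𝓞 F)) (hm : m ≠ 0) :
    {p : Ideal (𝓞 F) × Ideal (𝓞 F) | p.1 * p.2 = m}.Finite := by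
  refine ((finite_dvd m hm).prod (finite_dvd m hm)).subset ?_
  rintro ⟨d, e⟩ h
  have h : d * e = m := h
  exact ⟨⟨e, h.symm⟩, ⟨d, by rw [← h, mul_comm]⟩⟩

lemma sum_mu (m : Ideal (𝓞 F)) (hm : m ≠ 0) (h1 : m ≠ 1) :
    ∑ e ∈ (finite_dvd m hm).toFinset, (idealMu e : ℤ) = 0 := by
  have hu : ¬ IsUnit m := by rwa [Ideal.isUnit_iff, ← Ideal.one_eq_top]
  obtain ⟨P, hP, hPm⟩ := WfDvdMonoid.exists_irreducible_factor hu hm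
  have hPp : Prime P := hP.prime
  rw [← Finset.sum_filter_add_sum_filter_not _ (fun e => P ∣ e), add_comm, add_eq_zero_iff_eq_neg,
    ← Finset.sum_neg_distrib]
  have hzero : ∑ e ∈ (finite_dvd m hm).toFinset with P ∣ e, (idealMu e : ℤ)
     = ∑ e ∈ ((finite_dvd m hm).toFinset.filter (fun e => P ∣ e)).filter (fun e => Squarefree e),
        idealMu e := by
    symm
    refine Finset.sum_filter_of_ne ?_
    intro x _ hx
    by_contra h
    exact hx (by simp [idealMu, h])
  rw [Finset.sum_neg_distrib, hzero, ← Finset.sum_neg_distrib]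
  have hzero' : ∑ e ∈ (finite_dvd m hm).toFinset with ¬ P ∣ e, (idealMu e : ℤ)
     = ∑ e ∈ ((finite_dvd m hm).toFinset.filter (fun e => ¬ P ∣ e)).filter
        (fun e => Squarefree e), idealMu e := by
    symm
    refine Finset.sum_filter_of_ne ?_
    intro x _ hx
    by_contra h
    exact hx (by simp [idealMu, h])
  rw [hzero']
  have key : ∀ e : Ideal (𝓞 F), ¬ P ∣ e → IsRelPrime P e := fun e he =>
    hP.isRelPrime_iff_not_dvd.mpr he
  refine Finset.sum_bij (fun e _ => P * e) ?_ ?_ ?_ ?_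
  · intro e he
    simp only [Finset.mem_filter, Set.Finite.mem_toFinset, Set.mem_ofPred_eq] at he ⊢
    obtain ⟨⟨hd, hn⟩, hs⟩ := he
    exact ⟨⟨(key e hn).mul_dvd hPm hd, dvd_mul_right _ _⟩,
      squarefree_mul_iff.mpr ⟨key e hn, hP.squarefree, hs⟩⟩
  · intro a _ b _ h
    exact mul_left_cancel₀ hPp.ne_zero h
  · intro b hb
    simp only [Finset.mem_filter, Set.Finite.mem_toFinset, Set.mem_ofPred_eq] at hb
    obtain ⟨⟨hd, e, rfl⟩, hs⟩ := hb
    obtain ⟨h1, h2, h3⟩ := squarefree_mul_iff.mp hs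
    refine ⟨e, ?_, rfl⟩
    simp only [Finset.mem_filter, Set.Finite.mem_toFinset, Set.mem_ofPred_eq]
    exact ⟨⟨(dvd_mul_left _ _).trans hd, hP.isRelPrime_iff_not_dvd.mp h1⟩, h3⟩
  · intro e he
    simp only [Finset.mem_filter, Set.Finite.mem_toFinset, Set.mem_ofPred_eq] at he
    rw [idealMu_eq, idealMu_eq, (key e he.1.2).moebius_mul, hP.moebius_eq]
    ring

lemma sum_anti_mu (m : Ideal (𝓞 F)) (hm : m ≠ 0) :
    ∑ p ∈ (finite_anti m hm).toFinset, (idealMu p.2 : ℤ) = if m = 1 then 1 else 0 := by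
  have : ∑ p ∈ (finite_anti m hm).toFinset, (idealMu p.2 : ℤ)
      = ∑ e ∈ (finite_dvd m hm).toFinset, (idealMu e : ℤ) := by
    refine Finset.sum_bij (fun p _ => p.2) ?_ ?_ ?_ ?_
    · rintro ⟨d, e⟩ h
      simp only [Set.Finite.mem_toFinset, Set.mem_ofPred_eq] at h ⊢
      exact ⟨d, by rw [← h, mul_comm]⟩
    · rintro ⟨d, e⟩ h ⟨d', e'⟩ h' (rfl : e = e')
      simp only [Set.Finite.mem_toFinset, Set.mem_ofPred_eq] at h h'
      have he : e ≠ 0 := by rintro rfl; simp at h; exact hm h.symm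
      rw [mul_right_cancel₀ he (h.trans h'.symm)]
    · intro e he
      simp only [Set.Finite.mem_toFinset, Set.mem_ofPred_eq] at he
      obtain ⟨d, rfl⟩ := he
      exact ⟨(d, e), by simp [mul_comm], rfl⟩
    · intros; rfl
  rw [this]
  split_ifs with h
  · subst h
    have : (finite_dvd (1 : Ideal (𝓞 F)) hm).toFinset = {1} := by
      ext d
      simp only [Set.Finite.mem_toFinset, Set.mem_ofPred_eq, Finset.mem_singleton]
      rw [← isUnit_iff_dvd_one, Ideal.isUnit_iff, Ideal.one_eq_top]
    rw [this, Finset.sum_singleton, idealMu_eq, moebius_one]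
  · exact sum_mu m hm h

lemma abs_idealMu_le (I : Ideal (𝓞 F)) : ‖(idealMu I : ℂ)‖ ≤ 1 := by
  unfold idealMu
  split_ifs <;> simp

lemma ramanujanSum_eq (m n : Ideal (𝓞 F)) (hm : m ≠ 0) :
    (ramanujanSum m n : ℂ) = ∑ p ∈ (finite_anti m hm).toFinset,
      (if p.1 ∣ n then (Ideal.absNorm p.1 : ℂ) else 0) * idealMu p.2 := by
  unfold ramanujanSum
  rw [finsum_mem_eq_finite_toFinset_sum _ ((finite_anti m hm).subset (fun p hp => hp.1))]
  push_cast
  simp only [ite_mul, zero_mul]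
  rw [← Finset.sum_filter]
  refine Finset.sum_congr ?_ (fun _ _ => rfl)
  ext p
  simp

/-- multiplication on nonzero ideals -/
noncomputable def mulNZ (p : {I : Ideal (𝓞 F) // I ≠ 0} × {I : Ideal (𝓞 F) // I ≠ 0}) :
    {I : Ideal (𝓞 F) // I ≠ 0} := ⟨p.1.1 * p.2.1, mul_ne_zero p.1.2 p.2.2⟩

lemma tsum_fiber (m : {I : Ideal (𝓞 F) // I ≠ 0}) (G : Ideal (𝓞 F) → Ideal (𝓞 F) → ℂ) :
    ∑' p : (mulNZ (F := F)) ⁻¹' {m}, G p.1.1.1 p.1.2.1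
      = ∑ p ∈ (finite_anti m.1 m.2).toFinset, G p.1 p.2 := by
  rw [← Finset.tsum_subtype (finite_anti m.1 m.2).toFinset (fun p => G p.1 p.2)]
  let i : (mulNZ (F := F)) ⁻¹' {m} → {p // p ∈ (finite_anti m.1 m.2).toFinset} :=
    fun p => ⟨(p.1.1.1, p.1.2.1), by
      have := p.2
      simp only [Set.mem_preimage, Set.mem_singleton_iff, mulNZ] at this
      simp [← this]⟩
  have hi : Function.Bijective i := by
    constructor
    · rintro ⟨⟨⟨a, _⟩, ⟨b, _⟩⟩, _⟩ ⟨⟨⟨c, _⟩, ⟨d, _⟩⟩, _⟩ h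
      simp only [i, Subtype.mk.injEq, Prod.mk.injEq] at h
      obtain ⟨rfl, rfl⟩ := h
      rfl
    · rintro ⟨⟨a, b⟩, h⟩
      have h' : a * b = m.1 := by simpa using h
      have h0 : a * b ≠ 0 := h' ▸ m.2
      exact ⟨⟨(⟨a, left_ne_zero_of_mul h0⟩, ⟨b, right_ne_zero_of_mul h0⟩), Subtype.ext h'⟩, rfl⟩
  exact (Equiv.ofBijective i hi).tsum_eq (fun p => G p.1.1 p.1.2)

lemma summable_norm_rpow (x : ℝ) (hx : 1 < x) :
    Summable (fun I : {I : Ideal (𝓞 F) // I ≠ 0} => (Ideal.absNorm I.1 : ℝ) ^ (-x)) := by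
  have h1 : LSeriesSummable
      (fun k => (((Nat.card {I : Ideal (𝓞 F) // Ideal.absNorm I = k} : ℝ)) : ℂ)) (x : ℂ) := by
    refine LSeriesSummable_of_sum_norm_bigO_and_nonneg (r := 1) ?_ (fun _ => Nat.cast_nonneg _)
      zero_le_one (by simpa using hx)
    refine Asymptotics.isBigO_atTop_natCast_rpow_of_tendsto_div_rpow
      (a := dedekindZeta_residue F) ?_
    simp only [Real.rpow_one]
    refine ((Ideal.tendsto_norm_le_div_atTop₀ F).comp tendsto_natCast_atTop_atTop).congr fun n ↦ ?_
    simp only [Function.comp_apply, Nat.cast_le, ← Nat.cast_sum]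
    congr
    rw [← add_left_inj 1, ← Ideal.card_norm_le_eq_card_norm_le_add_one,
      show Finset.Icc 1 n = Finset.Ioc 0 n from Finset.Icc_succ_left_eq_Ioc _ _,
      show 1 = Nat.card {I : Ideal (𝓞 F) // Ideal.absNorm I = 0} by
        simp [Ideal.absNorm_eq_zero_iff],
      Finset.sum_Ioc_add_eq_sum_Icc (n.zero_le),
      ← Finset.card_preimage_eq_sum_card_image_eq
        (fun k _ ↦ Ideal.finite_setOfPred_absNorm_eq k)]
    simp [Set.coe_eq_subtype]
  have h2 := h1.norm
  rw [← (Equiv.sigmaFiberEquiv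
    (fun I : {I : Ideal (𝓞 F) // I ≠ 0} => Ideal.absNorm I.1)).summable_iff,
    summable_sigma_of_nonneg (fun _ => by simp only [Function.comp]; positivity)]
  have hfin : ∀ k, Finite {I : {I : Ideal (𝓞 F) // I ≠ 0} // Ideal.absNorm I.1 = k} := by
    intro k
    have : Finite {I : Ideal (𝓞 F) // Ideal.absNorm I = k} := Ideal.finite_setOfPred_absNorm_eq k
    exact Finite.of_injective
      (fun I => (⟨I.1.1, I.2⟩ : {I : Ideal (𝓞 F) // Ideal.absNorm I = k})) (by
        rintro ⟨⟨a, _⟩, _⟩ ⟨⟨b, _⟩, _⟩ h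
        simp only [Subtype.mk.injEq] at h
        subst h
        rfl)
  refine ⟨fun k => ?_, ?_⟩
  · have := hfin k
    exact Summable.of_finite
  · refine Summable.of_nonneg_of_le (fun k => tsum_nonneg fun _ => by
      simp only [Function.comp]; positivity) (fun k => ?_) h2
    have := hfin k
    have e1 : ∀ y : {I : {I : Ideal (𝓞 F) // I ≠ 0} // Ideal.absNorm I.1 = k},
        ((fun I : {I : Ideal (𝓞 F) // I ≠ 0} => (Ideal.absNorm I.1 : ℝ) ^ (-x)) ∘
          (Equiv.sigmaFiberEquiv
            (fun I : {I : Ideal (𝓞 F) // I ≠ 0} => Ideal.absNorm I.1))) ⟨k, y⟩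
          = (k : ℝ) ^ (-x) := by
      intro y
      simp [Equiv.sigmaFiberEquiv, y.2]
    rw [tsum_congr e1, tsum_const, nsmul_eq_mul, LSeries.norm_term_eq]
    have : Finite {I : Ideal (𝓞 F) // Ideal.absNorm I = k} := Ideal.finite_setOfPred_absNorm_eq k
    split_ifs with hk
    · subst hk
      have : IsEmpty {I : {I : Ideal (𝓞 F) // I ≠ 0} // Ideal.absNorm I.1 = 0} :=
        ⟨fun I => I.1.2 (Ideal.absNorm_eq_zero_iff.mp I.2)⟩
      simp
    · simp only [Complex.ofReal_re, Complex.norm_real, Real.norm_natCast]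
      rw [Real.rpow_neg (Nat.cast_nonneg _), ← div_eq_mul_inv]
      gcongr
      exact Nat.card_le_card_of_injective
        (fun I => (⟨I.1.1, I.2⟩ : {I : Ideal (𝓞 F) // Ideal.absNorm I = k})) (by
        rintro ⟨⟨a, _⟩, _⟩ ⟨⟨b, _⟩, _⟩ h
        simp only [Subtype.mk.injEq] at h
        subst h
        rfl)

lemma absNorm_ne (I : {I : Ideal (𝓞 F) // I ≠ 0}) : (Ideal.absNorm I.1 : ℂ) ≠ 0 := by
  rw [Nat.cast_ne_zero]
  exact fun h => I.2 (Ideal.absNorm_eq_zero_iff.mp h)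

lemma summable_cpow (s : ℂ) (hs : 1 < s.re) :
    Summable (fun I : {I : Ideal (𝓞 F) // I ≠ 0} => ‖(Ideal.absNorm I.1 : ℂ) ^ (-s)‖) := by
  refine (summable_norm_rpow (F := F) s.re hs).congr fun I => ?_
  rw [Complex.norm_natCast_cpow_of_pos (Nat.pos_of_ne_zero (by exact_mod_cast absNorm_ne I))]
  simp

lemma cpow_mul (s : ℂ) (I J : Ideal (𝓞 F)) : (Ideal.absNorm (I * J) : ℂ) ^ (-s)
    = (Ideal.absNorm I : ℂ) ^ (-s) * (Ideal.absNorm J : ℂ) ^ (-s) := by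
  rw [map_mul, Nat.cast_mul, Complex.natCast_mul_natCast_cpow]

lemma summable_mu (s : ℂ) (hs : 1 < s.re) :
    Summable (fun I : {I : Ideal (𝓞 F) // I ≠ 0} =>
      ‖(idealMu I.1 : ℂ) * (Ideal.absNorm I.1 : ℂ) ^ (-s)‖) := by
  refine Summable.of_nonneg_of_le (fun _ => norm_nonneg _) (fun I => ?_) (summable_cpow s hs)
  rw [norm_mul]
  exact mul_le_of_le_one_left (norm_nonneg _) (abs_idealMu_le _)

/-- Dirichlet convolution against the Möbius function. -/
lemma tsum_conv (s : ℂ) (hs : 1 < s.re) (f : Ideal (𝓞 F) → ℂ)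
    (hf : Summable (fun I : {I : Ideal (𝓞 F) // I ≠ 0} =>
      ‖f I.1 * (Ideal.absNorm I.1 : ℂ) ^ (-s)‖)) :
    (∑' I : {I : Ideal (𝓞 F) // I ≠ 0}, f I.1 * (Ideal.absNorm I.1 : ℂ) ^ (-s)) *
    (∑' I : {I : Ideal (𝓞 F) // I ≠ 0}, (idealMu I.1 : ℂ) * (Ideal.absNorm I.1 : ℂ) ^ (-s))
    = ∑' m : {I : Ideal (𝓞 F) // I ≠ 0},
      (∑ p ∈ (finite_anti m.1 m.2).toFinset, f p.1 * idealMu p.2) *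
        (Ideal.absNorm m.1 : ℂ) ^ (-s) := by
  rw [tsum_mul_tsum_of_summable_norm hf (summable_mu s hs)]
  have hS := summable_mul_of_summable_norm hf (summable_mu (F := F) s hs)
  rw [← (hS.hasSum.tsum_fiberwise (mulNZ (F := F))).tsum_eq]
  refine tsum_congr fun m => ?_
  rw [tsum_fiber m (fun d e => (f d * (Ideal.absNorm d : ℂ) ^ (-s)) *
    ((idealMu e : ℂ) * (Ideal.absNorm e : ℂ) ^ (-s))), Finset.sum_mul]
  refine Finset.sum_congr rfl fun p hp => ?_
  simp only [Set.Finite.mem_toFinset, Set.mem_ofPred_eq] at hp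
  rw [← hp, cpow_mul]
  ring

lemma dzeta_mul_mu (s : ℂ) (hs : 1 < s.re) :
    dzeta F s * (∑' I : {I : Ideal (𝓞 F) // I ≠ 0},
      (idealMu I.1 : ℂ) * (Ideal.absNorm I.1 : ℂ) ^ (-s)) = 1 := by
  have h := tsum_conv (F := F) s hs (fun _ => 1) (by simpa using summable_cpow s hs)
  simp only [one_mul] at h
  rw [dzeta, h, tsum_eq_single ⟨1, one_ne_zero⟩]
  · have := sum_anti_mu (1 : Ideal (𝓞 F)) one_ne_zero
    rw [← Int.cast_sum, this]
    simp
  · intro m hm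
    have := sum_anti_mu m.1 m.2
    rw [← Int.cast_sum, this, if_neg (fun h => hm (Subtype.ext h))]
    simp

lemma sigma_support (n : Ideal (𝓞 F)) (hn : n ≠ 0) (s : ℂ) :
    (Function.support (fun I : {I : Ideal (𝓞 F) // I ≠ 0} =>
      (if I.1 ∣ n then (Ideal.absNorm I.1 : ℂ) else 0) * (Ideal.absNorm I.1 : ℂ) ^ (-s))).Finite := by
  refine ((finite_dvd n hn).preimage Subtype.val_injective.injOn).subset ?_
  intro I hI
  by_contra h
  exact hI (by simp [show ¬ I.1 ∣ n from h])

lemma sigma_eq (n : Ideal (𝓞 F)) (hn : n ≠ 0) (s : ℂ) :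
    ∑' I : {I : Ideal (𝓞 F) // I ≠ 0},
      (if I.1 ∣ n then (Ideal.absNorm I.1 : ℂ) else 0) * (Ideal.absNorm I.1 : ℂ) ^ (-s)
    = sigmaIdeal (1 - s) n := by
  rw [tsum_eq_finsum (sigma_support n hn s), sigmaIdeal]
  have := finsum_mem_eq_of_bijOn (s := {I : {I : Ideal (𝓞 F) // I ≠ 0} | I.1 ∣ n})
    (t := {d : Ideal (𝓞 F) | d ∣ n})
    (f := fun I => (Ideal.absNorm I.1 : ℂ) ^ (1 - s))
    (g := fun d => (Ideal.absNorm d : ℂ) ^ (1 - s)) (fun I => I.1)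
    ⟨fun I h => h, Subtype.val_injective.injOn, fun d hd =>
      ⟨⟨d, ne_zero_of_dvd_ne_zero hn hd⟩, hd, rfl⟩⟩ (fun _ _ => rfl)
  rw [← this]
  refine finsum_congr fun I => ?_
  by_cases h : I.1 ∣ n
  · simp only [Set.mem_ofPred_eq, h, if_true, finsum_true]
    rw [sub_eq_add_neg, Complex.cpow_add _ _ (absNorm_ne I), Complex.cpow_one]
  · simp [h]

end helpers

theorem ramanujanSum_dirichlet_series (F : Type) [Field F] [NumberField F]
    (n : Ideal (𝓞 F)) (hn : n ≠ 0) (s : ℂ) (hs : 1 < s.re) :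
    ∑' m : {I : Ideal (𝓞 F) // I ≠ 0},
        (ramanujanSum m.1 n : ℂ) / (Ideal.absNorm m.1 : ℂ) ^ s
      = sigmaIdeal (1 - s) n / dzeta F s := by
  have h := tsum_conv (F := F) s hs (fun d => if d ∣ n then (Ideal.absNorm d : ℂ) else 0)
    (summable_of_hasFiniteSupport (by
      refine (sigma_support n hn s).subset ?_
      intro I hI
      simpa using hI))
  have h1 := dzeta_mul_mu (F := F) s hs
  have hz : dzeta F s ≠ 0 := left_ne_zero_of_mul_eq_one h1
  rw [sigma_eq n hn s] at h
  rw [div_eq_mul_inv _ (dzeta F s), ← eq_inv_of_mul_eq_one_right h1, h]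
  refine tsum_congr fun m => ?_
  rw [← ramanujanSum_eq m.1 n m.2, Complex.cpow_neg, div_eq_mul_inv]
end

section
/- Let 𝔽 be a number field, let n be a nonzero integral ideal of O_𝔽, and let s ∈ ℂ with Re(s) > 1. Then Σ_{nonzero ideals m} c*_m(n)/N(m)^s = (ζ_𝔽(s)/ζ_𝔽(2s))·σ_{1−s}(n). -/
open NumberField Classical

/-- The absolute Ramanujan sum `c*_m(n) = Σ_{d ∣ m, d ∣ n} N(d)·|μ(m/d)|`, written as a sum
over factorizations `m = d·e` with `d ∣ n` of `N(d)·|μ(e)|`. -/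
noncomputable def ramanujanSumStar {F : Type} [Field F] [NumberField F]
    (m n : Ideal (𝓞 F)) : ℤ :=
  ∑ᶠ p ∈ {p : Ideal (𝓞 F) × Ideal (𝓞 F) | p.1 * p.2 = m ∧ p.1 ∣ n},
    (Ideal.absNorm p.1 : ℤ) * |idealMu p.2|

open Filter Topology

lemma aux_summable_real (F : Type) [Field F] [NumberField F] (t : ℝ) (ht : 1 < t) :
    Summable (fun I : {I : Ideal (𝓞 F) // I ≠ 0} => (Ideal.absNorm I.1 : ℝ) ^ (-t)) := by
  have hO : (fun n : ℕ ↦ ∑ k ∈ Finset.Icc 1 n,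
      (Nat.card {I : Ideal (𝓞 F) // Ideal.absNorm I = k} : ℝ)) =O[atTop]
        fun n ↦ (n : ℝ) ^ (1 : ℝ) := by
    have h := (Ideal.tendsto_norm_le_div_atTop₀ F).comp tendsto_natCast_atTop_atTop
    have h1 := h.isBigO_one ℝ
    have h2 := h1.mul (Asymptotics.isBigO_refl (fun n : ℕ => (n : ℝ)) atTop)
    refine (h2.congr' ?_ ?_)
    · filter_upwards [eventually_ne_atTop 0] with n hn
      have hn' : (n : ℝ) ≠ 0 := by exact_mod_cast hn
      simp only [Function.comp_apply, Nat.cast_le, ← Nat.cast_sum]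
      rw [div_mul_cancel₀ _ hn']
      congr
      rw [← add_left_inj 1, ← Ideal.card_norm_le_eq_card_norm_le_add_one,
        show Finset.Icc 1 n = Finset.Ioc 0 n from Finset.Icc_succ_left_eq_Ioc _ _,
        show 1 = Nat.card {I : Ideal (𝓞 F) // Ideal.absNorm I = 0} by
          simp [Ideal.absNorm_eq_zero_iff],
        Finset.sum_Ioc_add_eq_sum_Icc (n.zero_le),
        ← Finset.card_preimage_eq_sum_card_image_eq
          (fun k _ ↦ Ideal.finite_setOfPred_absNorm_eq k)]
      simp [Set.coe_eq_subtype]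
    · filter_upwards with n
      simp
  have hL := LSeriesSummable_of_sum_norm_bigO_and_nonneg (s := (t : ℂ)) hO
    (fun _ => Nat.cast_nonneg _) zero_le_one (by simpa using ht)
  let g : {I : Ideal (𝓞 F) // I ≠ 0} → ℕ := fun I => Ideal.absNorm I.1
  have hfin : ∀ k, Finite {I : {I : Ideal (𝓞 F) // I ≠ 0} // g I = k} := fun k => by
    have : Finite {I : Ideal (𝓞 F) // Ideal.absNorm I = k} :=
      (Ideal.finite_setOfPred_absNorm_eq k)
    exact Finite.of_injective
      (fun I => (⟨I.1.1, I.2⟩ : {I : Ideal (𝓞 F) // Ideal.absNorm I = k}))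
      (fun a b h => by simpa [Subtype.ext_iff] using h)
  rw [← (Equiv.sigmaFiberEquiv g).summable_iff, summable_sigma_of_nonneg (fun _ => by
    simp only [Function.comp]; positivity)]
  refine ⟨fun k => Summable.of_finite, ?_⟩
  refine Summable.of_nonneg_of_le (fun k => tsum_nonneg fun _ => by
    simp only [Function.comp]; positivity) (fun k => ?_) hL.norm
  rcases Nat.eq_zero_or_pos k with rfl | hk
  · have : IsEmpty {I : {I : Ideal (𝓞 F) // I ≠ 0} // g I = 0} :=
      ⟨fun I => I.1.2 (Ideal.absNorm_eq_zero_iff.mp I.2)⟩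
    simp
  · have h1 : ∀ c : {I : {I : Ideal (𝓞 F) // I ≠ 0} // g I = k},
      ((fun I : {I : Ideal (𝓞 F) // I ≠ 0} => (Ideal.absNorm I.1 : ℝ) ^ (-t)) ∘
        (Equiv.sigmaFiberEquiv g)) ⟨k, c⟩ = (k : ℝ) ^ (-t) := by
      rintro ⟨c, hc⟩
      simp only [Function.comp, Equiv.sigmaFiberEquiv]
      subst hc
      rfl
    rw [tsum_congr h1, tsum_const, LSeries.norm_term_eq, if_neg hk.ne', nsmul_eq_mul,
      Real.rpow_neg (by positivity), div_eq_mul_inv]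
    simp only [Complex.ofReal_re]
    gcongr
    simp only [Complex.norm_real, Real.norm_natCast]
    rw [Nat.cast_le]
    have : Finite {I : Ideal (𝓞 F) // Ideal.absNorm I = k} :=
      (Ideal.finite_setOfPred_absNorm_eq k)
    exact Nat.card_le_card_of_injective
      (fun I => (⟨I.1.1, I.2⟩ : {I : Ideal (𝓞 F) // Ideal.absNorm I = k}))
      (fun a b h => by simpa [Subtype.ext_iff] using h)

lemma aux_norm {F : Type} [Field F] [NumberField F] (s : ℂ) (I : {I : Ideal (𝓞 F) // I ≠ 0}) :
    ‖(Ideal.absNorm I.1 : ℂ) ^ (-s)‖ = (Ideal.absNorm I.1 : ℝ) ^ (-s.re) := by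
  have : 0 < Ideal.absNorm I.1 := Nat.pos_of_ne_zero fun h => I.2 (Ideal.absNorm_eq_zero_iff.mp h)
  rw [Complex.norm_natCast_cpow_of_pos this, Complex.neg_re]

lemma aux_summable_norm (F : Type) [Field F] [NumberField F] (s : ℂ) (hs : 1 < s.re) :
    Summable (fun I : {I : Ideal (𝓞 F) // I ≠ 0} => ‖(Ideal.absNorm I.1 : ℂ) ^ (-s)‖) := by
  simp_rw [aux_norm]
  exact aux_summable_real F s.re hs

lemma aux_summable (F : Type) [Field F] [NumberField F] (s : ℂ) (hs : 1 < s.re) :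
    Summable (fun I : {I : Ideal (𝓞 F) // I ≠ 0} => (Ideal.absNorm I.1 : ℂ) ^ (-s)) :=
  (aux_summable_norm F s hs).of_norm

lemma aux_mul {F : Type} [Field F] [NumberField F] (s : ℂ) (I J : Ideal (𝓞 F)) :
    (Ideal.absNorm (I * J) : ℂ) ^ s = (Ideal.absNorm I : ℂ) ^ s * (Ideal.absNorm J : ℂ) ^ s := by
  rw [map_mul, Nat.cast_mul, Complex.natCast_mul_natCast_cpow]
open UniqueFactorizationMonoid

lemma aux_exists_sq {F : Type} [Field F] [NumberField F] (I : Ideal (𝓞 F)) (hI : I ≠ 0) :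
    ∃ e b : Ideal (𝓞 F), Squarefree e ∧ b ≠ 0 ∧ e * b ^ 2 = I := by
  induction I using UniqueFactorizationMonoid.induction_on_prime with
  | h₁ => exact absurd rfl hI
  | h₂ x hx => exact ⟨1, 1, squarefree_one, one_ne_zero,
      by rw [isUnit_iff_eq_one.mp hx, one_pow, one_mul]⟩
  | h₃ J P hJ hP ih =>
    obtain ⟨e, b, he, hb, rfl⟩ := ih hJ
    by_cases h : P ∣ e
    · obtain ⟨e', rfl⟩ := h
      exact ⟨e', P * b, he.of_mul_right, mul_ne_zero hP.ne_zero hb, by ring⟩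
    · refine ⟨P * e, b, ?_, hb, by ring⟩
      rw [squarefree_mul_iff]
      exact ⟨(hP.irreducible.isRelPrime_iff_not_dvd.mpr h), hP.irreducible.squarefree, he⟩

lemma aux_unique_sq {F : Type} [Field F] [NumberField F] {e b e' b' : Ideal (𝓞 F)}
    (he : Squarefree e) (he' : Squarefree e') (hb : b ≠ 0) (hb' : b' ≠ 0)
    (h : e * b ^ 2 = e' * b' ^ 2) : e = e' ∧ b = b' := by
  have he0 := he.ne_zero
  have he0' := he'.ne_zero
  have hn := (squarefree_iff_nodup_normalizedFactors he0).mp he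
  have hn' := (squarefree_iff_nodup_normalizedFactors he0').mp he'
  have key := congrArg normalizedFactors h
  rw [normalizedFactors_mul he0 (pow_ne_zero _ hb), normalizedFactors_mul he0' (pow_ne_zero _ hb'),
    normalizedFactors_pow, normalizedFactors_pow] at key
  have hc : ∀ P, (normalizedFactors e).count P = (normalizedFactors e').count P ∧
      (normalizedFactors b).count P = (normalizedFactors b').count P := by
    intro P
    have := congrArg (Multiset.count P) key
    simp only [Multiset.count_add, Multiset.count_nsmul] at this
    have h1 := Multiset.nodup_iff_count_le_one.mp hn P
    have h2 := Multiset.nodup_iff_count_le_one.mp hn' P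
    omega
  constructor
  · rw [← associated_iff_eq, associated_iff_normalizedFactors_eq_normalizedFactors he0 he0']
    exact Multiset.ext.mpr fun P => (hc P).1
  · rw [← associated_iff_eq, associated_iff_normalizedFactors_eq_normalizedFactors hb hb']
    exact Multiset.ext.mpr fun P => (hc P).2

lemma aux_abs_mu {F : Type} [Field F] [NumberField F] (e : Ideal (𝓞 F)) :
    |idealMu e| = if Squarefree e then 1 else 0 := by
  unfold idealMu
  split_ifs <;> simp

/-- Partial sum over ideals coprime to a finite set of primes. -/
noncomputable def auxCop (F : Type) [Field F] [NumberField F] (s : ℂ)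
    (S : Finset {P : Ideal (𝓞 F) // Prime P}) (I : {I : Ideal (𝓞 F) // I ≠ 0}) : ℂ :=
  if ∀ P ∈ S, ¬ P.1 ∣ I.1 then (Ideal.absNorm I.1 : ℂ) ^ (-s) else 0

lemma auxCop_norm_le {F : Type} [Field F] [NumberField F] (s : ℂ)
    (S : Finset {P : Ideal (𝓞 F) // Prime P}) (I : {I : Ideal (𝓞 F) // I ≠ 0}) :
    ‖auxCop F s S I‖ ≤ ‖(Ideal.absNorm I.1 : ℂ) ^ (-s)‖ := by
  unfold auxCop
  split_ifs <;> simp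

lemma auxCop_summable (F : Type) [Field F] [NumberField F] (s : ℂ) (hs : 1 < s.re)
    (S : Finset {P : Ideal (𝓞 F) // Prime P}) : Summable (auxCop F s S) :=
  Summable.of_norm_bounded (aux_summable_norm F s hs) (auxCop_norm_le s S)

lemma auxCop_insert (F : Type) [Field F] [NumberField F] (s : ℂ) (hs : 1 < s.re)
    (S : Finset {P : Ideal (𝓞 F) // Prime P}) (P : {P : Ideal (𝓞 F) // Prime P}) (hP : P ∉ S) :
    ∑' I, auxCop F s (insert P S) I =
      (1 - (Ideal.absNorm P.1 : ℂ) ^ (-s)) * ∑' I, auxCop F s S I := by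
  let h : {I : Ideal (𝓞 F) // I ≠ 0} → ℂ := fun I => if P.1 ∣ I.1 then auxCop F s S I else 0
  have hh : Summable h := by
    refine Summable.of_norm_bounded (aux_summable_norm F s hs) fun I => ?_
    simp only [h]
    split_ifs
    · exact auxCop_norm_le s S I
    · simp
  have h1 : ∀ I, auxCop F s (insert P S) I = auxCop F s S I - h I := by
    intro I
    simp only [h, auxCop, Finset.mem_insert, forall_eq_or_imp]
    by_cases ha : P.1 ∣ I.1 <;> simp [ha]
  let φ : {I : Ideal (𝓞 F) // I ≠ 0} → {I : Ideal (𝓞 F) // I ≠ 0} :=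
    fun J => ⟨P.1 * J.1, mul_ne_zero P.2.ne_zero J.2⟩
  have hφ : Function.Injective φ := fun a b hab => by
    simp only [φ, Subtype.mk.injEq] at hab
    exact Subtype.ext (mul_left_cancel₀ P.2.ne_zero hab)
  have h2 : ∑' I, h I = (Ideal.absNorm P.1 : ℂ) ^ (-s) * ∑' I, auxCop F s S I := by
    rw [← hφ.tsum_eq (f := h), ← tsum_mul_left]
    · refine tsum_congr fun J => ?_
      have hc : (∀ Q ∈ S, ¬ Q.1 ∣ P.1 * J.1) ↔ (∀ Q ∈ S, ¬ Q.1 ∣ J.1) := by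
        refine forall₂_congr fun Q hQ => not_congr ?_
        refine ⟨fun hd => (Q.2.dvd_or_dvd hd).resolve_left fun hd' => hP ?_,
          fun hd => hd.mul_left _⟩
        have : Q = P := Subtype.ext (associated_iff_eq.mp
          ((Q.2.dvd_prime_iff_associated P.2).mp hd'))
        exact this ▸ hQ
      simp only [h, φ, auxCop, dvd_mul_right, if_true, hc, aux_mul]
      split_ifs <;> simp
    · intro I hI
      simp only [h, Function.mem_support, ne_eq, ite_eq_right_iff, Classical.not_imp] at hI
      obtain ⟨J, hJ⟩ := hI.1
      refine ⟨⟨J, fun h0 => I.2 (by rw [hJ, h0, mul_zero])⟩, Subtype.ext hJ.symm⟩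
  rw [tsum_congr h1, (auxCop_summable F s hs S).tsum_sub hh, h2]
  ring

lemma aux_dzeta_ne_zero (F : Type) [Field F] [NumberField F] (s : ℂ) (hs : 1 < s.re) :
    dzeta F s ≠ 0 := by
  intro h0
  have hz : ∀ S, ∑' I, auxCop F s S I = 0 := by
    intro S
    induction S using Finset.induction_on with
    | empty => simpa [auxCop, dzeta] using h0
    | insert P S hP ih => rw [auxCop_insert F s hs S P hP, ih, mul_zero]
  have hlim : Tendsto (fun S => ∑' I, auxCop F s S I) atTop
      (𝓝 (∑' I : {I : Ideal (𝓞 F) // I ≠ 0}, if I.1 = 1 then (1 : ℂ) else 0)) := by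
    refine tendsto_tsum_of_dominated_convergence (aux_summable_norm F s hs) (fun I => ?_)
      (Eventually.of_forall fun S I => auxCop_norm_le s S I)
    by_cases hI : I.1 = 1
    · refine tendsto_const_nhds.congr fun S => ?_
      rw [if_pos hI, auxCop, if_pos, hI]
      · simp
      · intro P _ hd
        rw [hI] at hd
        exact P.2.not_isUnit (isUnit_of_dvd_one hd)
    · rw [if_neg hI]
      obtain ⟨P, hP, hd⟩ := WfDvdMonoid.exists_irreducible_factor
        (fun hu => hI (isUnit_iff_eq_one.mp hu)) I.2
      refine tendsto_const_nhds.congr' ?_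
      filter_upwards [eventually_ge_atTop {(⟨P, hP.prime⟩ : {P : Ideal (𝓞 F) // Prime P})}]
        with S hS
      rw [auxCop, if_neg]
      push Not
      exact ⟨_, hS (Finset.mem_singleton_self _), hd⟩
  simp only [hz] at hlim
  have h1 : (∑' I : {I : Ideal (𝓞 F) // I ≠ 0}, if I.1 = 1 then (1 : ℂ) else 0) = 1 := by
    rw [tsum_eq_single ⟨1, one_ne_zero⟩]
    · simp
    · intro b hb
      rw [if_neg]
      exact fun h => hb (Subtype.ext h)
  rw [h1] at hlim
  exact zero_ne_one (tendsto_nhds_unique tendsto_const_nhds hlim)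

lemma aux_sqfree_summable (F : Type) [Field F] [NumberField F] (s : ℂ) (hs : 1 < s.re) :
    Summable (fun e : {e : Ideal (𝓞 F) // Squarefree e} => ‖(Ideal.absNorm e.1 : ℂ) ^ (-s)‖) :=
  by
  let i : {e : Ideal (𝓞 F) // Squarefree e} → {I : Ideal (𝓞 F) // I ≠ 0} :=
    fun e => ⟨e.1, e.2.ne_zero⟩
  have hi : Function.Injective i := fun a b h => Subtype.ext (congrArg (fun x => x.1) h)
  have h := (aux_summable_norm F s hs).comp_injective hi
  rw [Function.comp_def] at h
  exact h

lemma aux_sqfree_mul (F : Type) [Field F] [NumberField F] (s : ℂ) (hs : 1 < s.re) :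
    (∑' e : {e : Ideal (𝓞 F) // Squarefree e}, (Ideal.absNorm e.1 : ℂ) ^ (-s)) *
      dzeta F (2 * s) = dzeta F s := by
  have hs2 : 1 < (2 * s).re := by
    rw [Complex.mul_re]; simp; linarith
  unfold dzeta
  rw [tsum_mul_tsum_of_summable_norm (aux_sqfree_summable F s hs) (aux_summable_norm F _ hs2)]
  let φ : {e : Ideal (𝓞 F) // Squarefree e} × {I : Ideal (𝓞 F) // I ≠ 0} →
      {I : Ideal (𝓞 F) // I ≠ 0} :=
    fun p => ⟨p.1.1 * p.2.1 ^ 2, mul_ne_zero p.1.2.ne_zero (pow_ne_zero _ p.2.2)⟩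
  have hφ : Function.Bijective φ := by
    constructor
    · intro p q hpq
      simp only [φ, Subtype.mk.injEq] at hpq
      obtain ⟨h1, h2⟩ := aux_unique_sq p.1.2 q.1.2 p.2.2 q.2.2 hpq
      exact Prod.ext (Subtype.ext h1) (Subtype.ext h2)
    · intro I
      obtain ⟨e, b, he, hb, h⟩ := aux_exists_sq I.1 I.2
      exact ⟨(⟨e, he⟩, ⟨b, hb⟩), Subtype.ext h⟩
  rw [← (Equiv.ofBijective φ hφ).tsum_eq]
  refine tsum_congr fun p => ?_
  simp only [Equiv.ofBijective_apply, φ, aux_mul, pow_two]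
  have hb : (Ideal.absNorm p.2.1 : ℂ) ≠ 0 :=
    Nat.cast_ne_zero.mpr fun h => p.2.2 (Ideal.absNorm_eq_zero_iff.mp h)
  rw [← Complex.cpow_add _ _ hb]
  ring_nf

lemma aux_finite_dvd {F : Type} [Field F] [NumberField F] (n : Ideal (𝓞 F)) (hn : n ≠ 0) :
    {d : Ideal (𝓞 F) | d ∣ n}.Finite := by
  have := UniqueFactorizationMonoid.fintypeSubtypeDvd n hn
  exact Finite.of_fintype {d : Ideal (𝓞 F) // d ∣ n}

lemma aux_fiber {F : Type} [Field F] [NumberField F]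
    (n : Ideal (𝓞 F)) (hn : n ≠ 0) (s : ℂ) (m : Ideal (𝓞 F)) (hm : m ≠ 0)
    (T : Set ({d : Ideal (𝓞 F) // d ∣ n} × {e : Ideal (𝓞 F) // Squarefree e}))
    (hT : ∀ p, p ∈ T ↔ p.1.1 * p.2.1 = m) :
    ∑' b : T, (Ideal.absNorm b.1.1.1 : ℂ) ^ (1 - s) * (Ideal.absNorm b.1.2.1 : ℂ) ^ (-s) =
      (ramanujanSumStar m n : ℂ) / (Ideal.absNorm m : ℂ) ^ s := by
  have hfin : {p : Ideal (𝓞 F) × Ideal (𝓞 F) | p.1 * p.2 = m ∧ p.1 ∣ n}.Finite := by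
    refine ((aux_finite_dvd m hm).prod (aux_finite_dvd m hm)).subset ?_
    rintro ⟨d, e⟩ ⟨h, -⟩
    exact ⟨⟨e, h.symm⟩, ⟨d, by rw [← h]; exact mul_comm _ _⟩⟩
  let ψ : {d : Ideal (𝓞 F) // d ∣ n} × {e : Ideal (𝓞 F) // Squarefree e} →
      Ideal (𝓞 F) × Ideal (𝓞 F) := fun p => (p.1.1, p.2.1)
  have hψ : Function.Injective ψ := fun p q h => by
    simp only [ψ, Prod.mk.injEq] at h
    exact Prod.ext (Subtype.ext h.1) (Subtype.ext h.2)
  let t : Set (Ideal (𝓞 F) × Ideal (𝓞 F)) :=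
    {p | p.1 * p.2 = m ∧ p.1 ∣ n ∧ Squarefree p.2}
  have hbij : Set.BijOn ψ T t := by
    refine ⟨fun p hp => ⟨(hT p).mp hp, p.1.2, p.2.2⟩, hψ.injOn, ?_⟩
    rintro ⟨d, e⟩ ⟨h1, h2, h3⟩
    exact ⟨(⟨d, h2⟩, ⟨e, h3⟩), (hT _).mpr h1, rfl⟩
  have hTfin : T.Finite := by
    refine Set.Finite.of_finite_image (f := ψ) (hfin.subset ?_) hψ.injOn
    rw [hbij.image_eq]
    exact fun p hp => ⟨hp.1, hp.2.1⟩
  have : Finite T := hTfin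
  rw [tsum_eq_finsum (Set.toFinite _), finsum_set_coe_eq_finsum_mem (s := T)
    (f := fun b => (Ideal.absNorm b.1.1 : ℂ) ^ (1 - s) * (Ideal.absNorm b.2.1 : ℂ) ^ (-s))]
  have hR : (ramanujanSumStar m n : ℂ) =
      ∑ᶠ p ∈ {p : Ideal (𝓞 F) × Ideal (𝓞 F) | p.1 * p.2 = m ∧ p.1 ∣ n},
        (((Ideal.absNorm p.1 : ℤ) * |idealMu p.2| : ℤ) : ℂ) :=
    (Int.castAddHom ℂ).map_finsum_mem _ hfin
  rw [hR, div_eq_mul_inv]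
  have hmul : (∑ᶠ p ∈ {p : Ideal (𝓞 F) × Ideal (𝓞 F) | p.1 * p.2 = m ∧ p.1 ∣ n},
      (((Ideal.absNorm p.1 : ℤ) * |idealMu p.2| : ℤ) : ℂ)) * ((Ideal.absNorm m : ℂ) ^ s)⁻¹ =
      ∑ᶠ p ∈ {p : Ideal (𝓞 F) × Ideal (𝓞 F) | p.1 * p.2 = m ∧ p.1 ∣ n},
      (((Ideal.absNorm p.1 : ℤ) * |idealMu p.2| : ℤ) : ℂ) * ((Ideal.absNorm m : ℂ) ^ s)⁻¹ :=
    (AddMonoidHom.mulRight ((Ideal.absNorm m : ℂ) ^ s)⁻¹).map_finsum_mem _ hfin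
  rw [hmul]
  have hst : ∑ᶠ p ∈ {p : Ideal (𝓞 F) × Ideal (𝓞 F) | p.1 * p.2 = m ∧ p.1 ∣ n},
      (((Ideal.absNorm p.1 : ℤ) * |idealMu p.2| : ℤ) : ℂ) * ((Ideal.absNorm m : ℂ) ^ s)⁻¹ =
      ∑ᶠ p ∈ t,
      (((Ideal.absNorm p.1 : ℤ) * |idealMu p.2| : ℤ) : ℂ) * ((Ideal.absNorm m : ℂ) ^ s)⁻¹ := by
    refine finsum_mem_inter_support_eq' _ _ _ fun p hp => ?_
    have : Squarefree p.2 := by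
      by_contra h
      apply hp
      simp [aux_abs_mu, h]
    simp [t, this]
  rw [hst]
  refine finsum_mem_eq_of_bijOn ψ hbij fun p hp => ?_
  rw [← (hT p).mp hp, aux_mul]
  have hd : (Ideal.absNorm p.1.1 : ℂ) ≠ 0 :=
    Nat.cast_ne_zero.mpr fun h => by
      have h0 := p.1.2
      rw [Ideal.absNorm_eq_zero_iff.mp h] at h0
      exact hn (zero_dvd_iff.mp h0)
  have : (((Ideal.absNorm (ψ p).1 : ℤ) * |idealMu (ψ p).2| : ℤ) : ℂ) = Ideal.absNorm p.1.1 := by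
    simp [ψ, aux_abs_mu, p.2.2]
  rw [this, sub_eq_add_neg, Complex.cpow_add _ _ hd, Complex.cpow_one, mul_inv, Complex.cpow_neg,
    Complex.cpow_neg]
  ring

theorem ramanujanSumStar_dirichlet_series (F : Type) [Field F] [NumberField F]
    (n : Ideal (𝓞 F)) (hn : n ≠ 0) (s : ℂ) (hs : 1 < s.re) :
    ∑' m : {I : Ideal (𝓞 F) // I ≠ 0},
        (ramanujanSumStar m.1 n : ℂ) / (Ideal.absNorm m.1 : ℂ) ^ s
      = dzeta F s / dzeta F (2 * s) * sigmaIdeal (1 - s) n := by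
  have hs2 : 1 < (2 * s).re := by
    rw [Complex.mul_re]; simp; linarith
  rw [← aux_sqfree_mul F s hs, mul_div_cancel_right₀ _ (aux_dzeta_ne_zero F _ hs2)]
  have : Finite {d : Ideal (𝓞 F) // d ∣ n} := aux_finite_dvd n hn
  have hσ : sigmaIdeal (1 - s) n =
      ∑' d : {d : Ideal (𝓞 F) // d ∣ n}, (Ideal.absNorm d.1 : ℂ) ^ (1 - s) := by
    rw [tsum_eq_finsum (Set.toFinite _), sigmaIdeal]
    exact (finsum_set_coe_eq_finsum_mem (s := {d : Ideal (𝓞 F) | d ∣ n})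
      (f := fun d => (Ideal.absNorm d : ℂ) ^ (1 - s))).symm
  have hfn : Summable fun d : {d : Ideal (𝓞 F) // d ∣ n} =>
      ‖(Ideal.absNorm d.1 : ℂ) ^ (1 - s)‖ := Summable.of_finite
  have hgn := aux_sqfree_summable F s hs
  rw [hσ, mul_comm, tsum_mul_tsum_of_summable_norm hfn hgn]
  have hsum := (summable_mul_of_summable_norm hfn hgn).hasSum
  let φ : {d : Ideal (𝓞 F) // d ∣ n} × {e : Ideal (𝓞 F) // Squarefree e} →
      {I : Ideal (𝓞 F) // I ≠ 0} :=
    fun p => ⟨p.1.1 * p.2.1, mul_ne_zero (ne_zero_of_dvd_ne_zero hn p.1.2) p.2.2.ne_zero⟩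
  rw [← (hsum.tsum_fiberwise φ).tsum_eq]
  refine tsum_congr fun m => ?_
  exact (aux_fiber n hn s m.1 m.2 (φ ⁻¹' {m}) fun p => by simp [φ, Subtype.ext_iff]).symm
end
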